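/- arXiv:1511.04645 — 2 statements merged into one kernel-verified Lean document; each statement's English description precedes it below -/
import Mathlib

section
/- Let g, h ∈ G(Γ) and set d = |h⁻¹g|_r. Then every syllable of (any reduced word representing) h⁻¹g is either a syllable from the d-tail of g, the inverse of a syllable from the d-tail of h, or an amalgamation h_i⁻¹g_j of the inverse of a syllable h_i from the d-tail of h with a syllable g_j from the d-tail of g lying in the same vertex group. -/
open scoped ComplexOrder commutatorElement

/-! ## Operator-norm notions -/

/-- `φ` is completely bounded (as a Herz–Schur multiplier) with cb-norm at most `C`:
there are a Hilbert space `H` and bounded maps `α β : G → H` with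
`φ (h⁻¹ * g) = ⟪α g, β h⟫` and `(sup ‖α‖) * (sup ‖β‖) ≤ C`. -/
def HasCBNormBound {G : Type} [Group G] (φ : G → ℂ) (C : ℝ) : Prop :=
  ∃ (H : Type) (_ : NormedAddCommGroup H) (_ : InnerProductSpace ℂ H)
    (α β : G → H) (Ca Cb : ℝ),
      (∀ g, ‖α g‖ ≤ Ca) ∧ (∀ h, ‖β h‖ ≤ Cb) ∧ Ca * Cb ≤ C ∧
      ∀ g h : G, φ (h⁻¹ * g) = (inner ℂ (α g) (β h) : ℂ)

/-- A kernel `φ : G × G → ℂ` is completely bounded with cb-norm at most `C`. -/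
def HasCBKernelBound {G : Type} (φ : G → G → ℂ) (C : ℝ) : Prop :=
  ∃ (H : Type) (_ : NormedAddCommGroup H) (_ : InnerProductSpace ℂ H)
    (α β : G → H) (Ca Cb : ℝ),
      (∀ g, ‖α g‖ ≤ Ca) ∧ (∀ h, ‖β h‖ ≤ Cb) ∧ Ca * Cb ≤ C ∧
      ∀ g h : G, φ g h = (inner ℂ (α g) (β h) : ℂ)

/-- A function `φ : G → ℂ` is positive definite. -/
def IsPosDefFn {G : Type} [Group G] (φ : G → ℂ) : Prop :=
  ∀ (n : ℕ) (c : Fin n → ℂ) (x : Fin n → G),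
    0 ≤ ∑ i, ∑ j, c i * (starRingEnd ℂ) (c j) * φ ((x j)⁻¹ * x i)

/-- A kernel `Ψ : G × G → ℂ` is positive definite. -/
def IsPosDefKernel {X : Type} (Ψ : X → X → ℂ) : Prop :=
  ∀ (n : ℕ) (c : Fin n → ℂ) (x : Fin n → X),
    0 ≤ ∑ i, ∑ j, c i * (starRingEnd ℂ) (c j) * Ψ (x i) (x j)

/-- A (discrete) group is amenable iff it admits an approximate identity of finitely
supported positive definite functions; we use this characterization. -/
def AmenablePD (G : Type) [Group G] : Prop :=
  ∀ (S : Finset G) (ε : ℝ), 0 < ε →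
    ∃ φ : G → ℂ, (Function.support φ).Finite ∧ IsPosDefFn φ ∧ ∀ g ∈ S, ‖φ g - 1‖ < ε

/-- A group is weakly amenable with Cowling–Haagerup constant 1: there is a net of finitely
supported completely bounded functions converging to 1 pointwise with cb-norms with
limsup at most 1. -/
def WeaklyAmenableCH1 (G : Type) [Group G] : Prop :=
  ∀ (S : Finset G) (ε : ℝ), 0 < ε →
    ∃ φ : G → ℂ, (Function.support φ).Finite ∧ HasCBNormBound φ (1 + ε) ∧
      ∀ g ∈ S, ‖φ g - 1‖ < ε

/-! ## Graph products -/

section GraphProd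

variable {V : Type} (Γ : SimpleGraph V) (G : V → Type) [∀ v, Group (G v)]

/-- The commutators `[G_v, G_w]` over the edges of `Γ`. -/
def commRels : Set (Monoid.CoprodI G) :=
  {x | ∃ (v w : V) (a : G v) (b : G w), Γ.Adj v w ∧
    x = ⁅Monoid.CoprodI.of a, Monoid.CoprodI.of b⁆}

/-- The graph product of the groups `G v` over the graph `Γ`. -/
abbrev GraphProduct :=
  Monoid.CoprodI G ⧸ Subgroup.normalClosure (commRels Γ G)

/-- The image in the graph product of a syllable, i.e. an element of a vertex group. -/
def ofSyl (s : (v : V) × G v) : GraphProduct Γ G :=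
  QuotientGroup.mk (Monoid.CoprodI.of s.2)

/-- The element of the graph product represented by a formal word of syllables. -/
def wordProd (w : List ((v : V) × G v)) : GraphProduct Γ G :=
  (w.map (ofSyl Γ G)).prod

/-- `w` is a formal word of nontrivial syllables representing `g`. -/
def IsWordOf (w : List ((v : V) × G v)) (g : GraphProduct Γ G) : Prop :=
  (∀ s ∈ w, s.2 ≠ 1) ∧ wordProd Γ G w = g

/-- The reduced word length `|g|_r`. -/
noncomputable def redLength (g : GraphProduct Γ G) : ℕ :=
  sInf {n | ∃ w, IsWordOf Γ G w g ∧ w.length = n}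

/-- `w` is a reduced word representing `g` : a representing word of nontrivial syllables
of minimal syllable length. -/
def IsReducedWordOf (w : List ((v : V) × G v)) (g : GraphProduct Γ G) : Prop :=
  IsWordOf Γ G w g ∧ ∀ w', IsWordOf Γ G w' g → w.length ≤ w'.length

/-- `κ`: the maximal number of mutually adjacent vertices of `Γ`. -/
noncomputable def kappa : ℕ :=
  sSup {n | ∃ s : Finset V, Γ.IsNClique n s}

/-- The `d`-tail of `g`: syllables appearing among the last `d` syllables of some reduced
word representing `g`. -/
def dTail (g : GraphProduct Γ G) (d : ℕ) : Set ((v : V) × G v) :=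
  {s | ∃ w, IsReducedWordOf Γ G w g ∧ s ∈ w.drop (w.length - d)}

/-- `g` begins with `G_v`. -/
def BeginsWith (g : GraphProduct Γ G) (v : V) : Prop :=
  ∃ w s, IsReducedWordOf Γ G w g ∧ w.head? = some s ∧ s.1 = v

/-- `g` ends with `G(lk(v))`: some reduced word for `g` has last syllable in a vertex
group adjacent to `v`. -/
def EndsWithLink (g : GraphProduct Γ G) (v : V) : Prop :=
  ∃ w s, IsReducedWordOf Γ G w g ∧ w.getLast? = some s ∧ Γ.Adj s.1 v

/-- The half-space `𝔸_v` of elements beginning with `G_v`. -/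
noncomputable def halfSpace (v : V) : Set (GraphProduct Γ G) :=
  {g | ∃ gv : G v, redLength Γ G (ofSyl Γ G ⟨v, gv⟩ * g) < redLength Γ G g}

/-- Left translate `k • s` of a subset of the graph product. -/
def wallTrans (k : GraphProduct Γ G) (s : Set (GraphProduct Γ G)) : Set (GraphProduct Γ G) :=
  (fun x => k * x) '' s

/-- Two walls (given by their preferred half-spaces) cross if all four intersections of
half-spaces are nonempty. -/
def Cross {X : Type} (s t : Set X) : Prop :=
  (s ∩ t).Nonempty ∧ (s ∩ tᶜ).Nonempty ∧ (sᶜ ∩ t).Nonempty ∧ (sᶜ ∩ tᶜ).Nonempty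

/-- The set of walls `𝕎 = {k𝔸_v}`. -/
noncomputable def Walls : Set (Set (GraphProduct Γ G)) :=
  {s | ∃ (k : GraphProduct Γ G) (v : V), s = wallTrans Γ G k (halfSpace Γ G v)}

/-- The wall (pseudo)distance: the number of walls separating `x` and `y`. -/
noncomputable def wallDist (x y : GraphProduct Γ G) : ℕ :=
  {s | s ∈ Walls Γ G ∧ Xor' (x ∈ s) (y ∈ s)}.ncard

end GraphProd


/-- The image in the free product `A ∗ B` of a syllable. -/
def sylEmb (A B : Type) [Group A] [Group B] : A ⊕ B → Monoid.Coprod A B :=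
  Sum.elim (fun a => Monoid.Coprod.inl a) (fun b => Monoid.Coprod.inr b)


section Helpers

open Classical in
/-- Universal property of graph products. -/
noncomputable def gpLift {V : Type} (Γ : SimpleGraph V) (G : V → Type) [∀ v, Group (G v)]
    {K : Type} [Group K] (f : ∀ v, G v →* K)
    (hf : ∀ v w a b, Γ.Adj v w → Commute (f v a) (f w b)) : GraphProduct Γ G →* K :=
  QuotientGroup.lift _ (Monoid.CoprodI.lift f) (by
    have : Subgroup.normalClosure (commRels Γ G) ≤ (Monoid.CoprodI.lift f).ker := by
      apply Subgroup.normalClosure_le_normal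
      rintro x ⟨v, w, a, b, hvw, rfl⟩
      have := hf v w a b hvw
      simp only [SetLike.mem_coe, MonoidHom.mem_ker, map_commutatorElement,
        Monoid.CoprodI.lift_of]
      exact commutatorElement_eq_one_iff_commute.2 this
    intro x hx
    exact this hx)

variable {V : Type} {Γ : SimpleGraph V} {G : V → Type} [∀ v, Group (G v)]

theorem gpLift_ofSyl {K : Type} [Group K] (f : ∀ v, G v →* K)
    (hf : ∀ v w a b, Γ.Adj v w → Commute (f v a) (f w b)) (v : V) (a : G v) :
    gpLift Γ G f hf (ofSyl Γ G ⟨v, a⟩) = f v a := by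
  unfold gpLift ofSyl
  erw [QuotientGroup.lift_mk]

variable (Γ G) in
/-- Vertex group hom. -/
noncomputable def sylHom (v : V) : G v →* GraphProduct Γ G :=
  (QuotientGroup.mk' _).comp Monoid.CoprodI.of

theorem sylHom_apply (v : V) (a : G v) : sylHom Γ G v a = ofSyl Γ G ⟨v, a⟩ := rfl

theorem ofSyl_mul (v : V) (a b : G v) :
    ofSyl Γ G ⟨v, a * b⟩ = ofSyl Γ G ⟨v, a⟩ * ofSyl Γ G ⟨v, b⟩ := by
  simp [← sylHom_apply]

theorem ofSyl_one (v : V) : ofSyl Γ G ⟨v, 1⟩ = 1 := by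
  simp [← sylHom_apply]

theorem ofSyl_inv (v : V) (a : G v) :
    ofSyl Γ G ⟨v, a⁻¹⟩ = (ofSyl Γ G ⟨v, a⟩)⁻¹ := by
  simp [← sylHom_apply]

theorem ofSyl_comm {v w : V} (h : Γ.Adj v w) (a : G v) (b : G w) :
    Commute (ofSyl Γ G ⟨v, a⟩) (ofSyl Γ G ⟨w, b⟩) := by
  rw [← commutatorElement_eq_one_iff_commute]
  have : (QuotientGroup.mk' (Subgroup.normalClosure (commRels Γ G)))
      ⁅Monoid.CoprodI.of a, Monoid.CoprodI.of b⁆ = 1 := by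
    rw [QuotientGroup.mk'_apply, QuotientGroup.eq_one_iff]
    exact Subgroup.subset_normalClosure ⟨v, w, a, b, h, rfl⟩
  rw [map_commutatorElement] at this
  exact this

@[simp] theorem wordProd_nil : wordProd Γ G [] = 1 := by simp [wordProd]
@[simp] theorem wordProd_cons (s w) :
    wordProd Γ G (s :: w) = ofSyl Γ G s * wordProd Γ G w := by simp [wordProd]
@[simp] theorem wordProd_append (w w') :
    wordProd Γ G (w ++ w') = wordProd Γ G w * wordProd Γ G w' := by simp [wordProd]

theorem exists_word (g : GraphProduct Γ G) : ∃ w, wordProd Γ G w = g := by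
  induction g using QuotientGroup.induction_on with
  | H x =>
    induction x using Monoid.CoprodI.induction_on with
    | one => exact ⟨[], by simp⟩
    | of i m => exact ⟨[⟨i, m⟩], by simp [ofSyl]⟩
    | mul x y hx hy =>
      obtain ⟨a, ha⟩ := hx
      obtain ⟨b, hb⟩ := hy
      exact ⟨a ++ b, by rw [wordProd_append, ha, hb]; rfl⟩

/-- star membership -/
def inStar (Γ : SimpleGraph V) (v u : V) : Prop := u = v ∨ Γ.Adj u v

variable (Γ G) in
/-- The star subgroup. -/
def starSub (v : V) : Subgroup (GraphProduct Γ G) :=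
  Subgroup.closure {x | ∃ s : (u : V) × G u, inStar Γ v s.1 ∧ x = ofSyl Γ G s}

theorem ofSyl_mem {v : V} {s : (u : V) × G u} (h : inStar Γ v s.1) :
    ofSyl Γ G s ∈ starSub Γ G v := Subgroup.subset_closure ⟨s, h, rfl⟩

open Classical in
/-- indicator function -/
noncomputable def indic (u v : V) (a : G v) : GraphProduct Γ G → G u := fun y =>
  if h : v = u then (if y ∈ starSub Γ G u then h ▸ a else 1) else 1

open Classical in
theorem indic_same (v : V) (a : G v) (y : GraphProduct Γ G) :
    indic v v a y = if y ∈ starSub Γ G v then a else 1 := by simp [indic]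

theorem indic_ne {u v : V} (h : v ≠ u) (a : G v) (y : GraphProduct Γ G) :
    indic u v a y = 1 := by simp [indic, h]

theorem indic_inv {u v w : V} (h : inStar Γ u w) (a : G v) (b : G w) (y : GraphProduct Γ G) :
    indic u v a ((ofSyl Γ G ⟨w, b⟩)⁻¹ * y) = indic u v a y := by
  have hm : ofSyl Γ G ⟨w, b⟩ ∈ starSub Γ G u := ofSyl_mem h
  unfold indic
  rw [Subgroup.mul_mem_cancel_left _ (inv_mem hm)]

variable (Γ G) in
/-- The semidirect product. -/
abbrev SD (u : V) := SemidirectProduct (GraphProduct Γ G → G u) (GraphProduct Γ G)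
  (mulAutArrow (G := GraphProduct Γ G) (A := GraphProduct Γ G) (M := G u))

theorem arrow_apply (u : V) (g : GraphProduct Γ G) (f : GraphProduct Γ G → G u)
    (y : GraphProduct Γ G) :
    (mulAutArrow (G := GraphProduct Γ G) (A := GraphProduct Γ G) (M := G u)) g f y
      = f (g⁻¹ * y) := rfl

/-- generators of the cocycle hom -/
noncomputable def psiGen (u v : V) : G v →* SD Γ G u where
  toFun a := ⟨indic u v a, ofSyl Γ G ⟨v, a⟩⟩
  map_one' := by
    ext y
    · simp [indic]; intro h; subst h; simp
    · simp [ofSyl_one]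
  map_mul' a b := by
    ext y
    · simp only [SemidirectProduct.mul_left, Pi.mul_apply, arrow_apply]
      by_cases h : v = u
      · subst h
        rw [indic_inv (Or.inl rfl), indic_same, indic_same, indic_same]
        split_ifs <;> simp
      · simp [indic_ne h]
    · simp [ofSyl_mul]

variable (Γ G) in
/-- The cocycle hom. -/
noncomputable def psi (u : V) : GraphProduct Γ G →* SD Γ G u :=
  gpLift Γ G (psiGen u) (by
    intro v w a b h
    unfold Commute SemiconjBy
    ext y
    · simp only [SemidirectProduct.mul_left, Pi.mul_apply, arrow_apply, psiGen,
        MonoidHom.coe_mk, OneHom.coe_mk]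
      by_cases hv : v = u
      · subst hv
        have hw : w ≠ v := h.ne'
        rw [indic_ne hw, indic_ne hw, indic_inv (Or.inr h.symm)]; simp
      · rw [indic_ne hv, indic_ne hv]
        by_cases hw : w = u
        · subst hw
          rw [indic_inv (Or.inr h)]; simp
        · simp [indic_ne hw]
    · simp only [SemidirectProduct.mul_right, psiGen, MonoidHom.coe_mk, OneHom.coe_mk]
      exact ofSyl_comm h a b)

theorem psi_ofSyl (u v : V) (a : G v) :
    psi Γ G u (ofSyl Γ G ⟨v, a⟩) = ⟨indic u v a, ofSyl Γ G ⟨v, a⟩⟩ := by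
  unfold psi
  rw [gpLift_ofSyl]; rfl

theorem psi_right (u : V) (g : GraphProduct Γ G) : (psi Γ G u g).right = g := by
  obtain ⟨w, rfl⟩ := exists_word g
  induction w with
  | nil => simp
  | cons s w ih =>
    rcases s with ⟨v, a⟩
    simp [ih, psi_ofSyl]

/-- label of the hyperplane of `y` of type `u`, as crossed by `g`. -/
noncomputable def lab (u : V) (g y : GraphProduct Γ G) : G u := (psi Γ G u g).left y

theorem lab_one (u : V) (y : GraphProduct Γ G) : lab u 1 y = 1 := by simp [lab]

theorem lab_mul (u : V) (g h y : GraphProduct Γ G) :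
    lab u (g * h) y = lab u g y * lab u h (g⁻¹ * y) := by
  simp only [lab, map_mul, SemidirectProduct.mul_left, Pi.mul_apply, arrow_apply, psi_right]

theorem lab_ofSyl (u v : V) (a : G v) (y : GraphProduct Γ G) :
    lab u (ofSyl Γ G ⟨v, a⟩) y = indic u v a y := by
  simp [lab, psi_ofSyl]

theorem lab_inv (u : V) (g y : GraphProduct Γ G) :
    lab u g⁻¹ y = (lab u g (g * y))⁻¹ := by
  have := lab_mul u g g⁻¹ (g * y)
  rw [mul_inv_cancel, lab_one, inv_mul_cancel_left] at this
  exact eq_inv_of_mul_eq_one_right this.symm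

theorem lab_congr (u : V) (g y y' : GraphProduct Γ G) (h : y⁻¹ * y' ∈ starSub Γ G u) :
    lab u g y' = lab u g y := by
  obtain ⟨w, rfl⟩ := exists_word g
  induction w generalizing y y' with
  | nil => simp [lab_one]
  | cons s w ih =>
    rcases s with ⟨v, a⟩
    rw [wordProd_cons, lab_mul, lab_mul, lab_ofSyl, lab_ofSyl]
    congr 1
    · have : y' ∈ starSub Γ G u ↔ y ∈ starSub Γ G u := by
        have e : y' = y * (y⁻¹ * y') := by group
        rw [e, Subgroup.mul_mem_cancel_right _ h]
      by_cases hy : y ∈ starSub Γ G u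
      · simp [indic, hy, this.2 hy]
      · simp [indic, hy, mt this.1 hy]
    · apply ih
      convert h using 1
      group

/-- Labels of elements of the star subgroup. -/
theorem lab_star {u v : V} (huv : ¬ Γ.Adj u v) (z : GraphProduct Γ G)
    (hz : z ∈ starSub Γ G v) (y : GraphProduct Γ G) (hy : u = v → y ∉ starSub Γ G v) :
    lab u z y = 1 := by
  unfold starSub at hz
  induction hz using Subgroup.closure_induction generalizing y with
  | mem x hx =>
    obtain ⟨⟨t, a⟩, ht, rfl⟩ := hx
    rw [lab_ofSyl]
    by_cases h : t = u
    · subst h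
      rcases ht with ht | ht
      · simp only at ht
        subst ht
        simp [indic_same, hy rfl]
      · exact absurd ht huv
    · exact indic_ne h _ _
  | one => exact lab_one _ _
  | mul x z hx hz ihx ihz =>
    rw [lab_mul, ihx y hy, ihz, one_mul]
    intro e hm
    exact hy e ((Subgroup.mul_mem_cancel_left _ (inv_mem hx)).1 hm)
  | inv x hx ih =>
    rw [lab_inv, ih, inv_one]
    intro e hm
    exact hy e ((Subgroup.mul_mem_cancel_left _ hx).1 hm)

theorem lab_exists (u : V) (w : List ((v : V) × G v)) (y : GraphProduct Γ G)
    (h : lab u (wordProd Γ G w) y ≠ 1) :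
    ∃ w1 a w2, w = w1 ++ ⟨u, a⟩ :: w2 ∧ (wordProd Γ G w1)⁻¹ * y ∈ starSub Γ G u := by
  induction w generalizing y with
  | nil => simp [lab_one] at h
  | cons s w ih =>
    rcases s with ⟨v, a⟩
    rw [wordProd_cons, lab_mul, lab_ofSyl] at h
    by_cases h2 : lab u (wordProd Γ G w) ((ofSyl Γ G ⟨v, a⟩)⁻¹ * y) = 1
    · rw [h2, mul_one] at h
      by_cases hv : v = u
      · subst hv
        rw [indic_same] at h
        refine ⟨[], a, w, rfl, ?_⟩
        by_contra hc
        apply h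
        rw [if_neg]
        simpa using hc
      · exact absurd (indic_ne hv _ _) h
    · obtain ⟨w1, b, w2, rfl, hm⟩ := ih _ h2
      exact ⟨⟨v, a⟩ :: w1, b, w2, rfl, by simpa [mul_assoc] using hm⟩

variable (Γ) in
/-- reduced words -/
def Red (w : List ((v : V) × G v)) : Prop := IsReducedWordOf Γ G w (wordProd Γ G w)

theorem Red.le {w w' : List ((v : V) × G v)} (h : Red Γ w)
    (e : wordProd Γ G w' = wordProd Γ G w) : w.length ≤ w'.length := by
  classical
  have key : ∀ w : List ((v : V) × G v),
      wordProd Γ G (w.filter (fun s => s.2 ≠ 1)) = wordProd Γ G w := by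
    intro w
    induction w with
    | nil => rfl
    | cons s w ih =>
      rcases s with ⟨v, a⟩
      by_cases ha : a = 1
      · subst ha
        rw [List.filter_cons_of_neg (by simp), ih]; simp [ofSyl_one]
      · rw [List.filter_cons_of_pos (by simpa using ha)]; simp only [wordProd_cons, ih]
  refine (h.2 (w'.filter (fun s => s.2 ≠ 1)) ⟨?_, ?_⟩).trans (List.length_filter_le _ _)
  · intro s hs; simpa using (List.mem_filter.1 hs).2
  · rw [key, e]

theorem Red.ne {w : List ((v : V) × G v)} (h : Red Γ w) {s} (hs : s ∈ w) : s.2 ≠ 1 :=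
  h.1.1 s hs

theorem Red.mk' {w w' : List ((v : V) × G v)} (h : Red Γ w)
    (e : wordProd Γ G w' = wordProd Γ G w) (hl : w'.length ≤ w.length)
    (hn : ∀ s ∈ w', s.2 ≠ 1) : Red Γ w' :=
  ⟨⟨hn, rfl⟩, fun w'' h'' => hl.trans (h.2 w'' ⟨h''.1, h''.2.trans e⟩)⟩

theorem Red.infix {a b c : List ((v : V) × G v)} (h : Red Γ (a ++ b ++ c)) : Red Γ b := by
  refine ⟨⟨fun s hs => h.ne (by simp [hs]), rfl⟩, fun w' h' => ?_⟩
  have := h.le (w' := a ++ w' ++ c) (by simp [h'.2])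
  simp at this
  omega

theorem Red.left {a b : List ((v : V) × G v)} (h : Red Γ (a ++ b)) : Red Γ a :=
  Red.infix (a := []) (c := b) (by simpa using h)

theorem Red.right {a b : List ((v : V) × G v)} (h : Red Γ (a ++ b)) : Red Γ b :=
  Red.infix (a := a) (c := []) (by simpa using h)

theorem exists_red (g : GraphProduct Γ G) : ∃ w, Red Γ w ∧ wordProd Γ G w = g := by
  classical
  have hex : ∃ n, ∃ w, IsWordOf Γ G w g ∧ w.length = n := by
    obtain ⟨w, rfl⟩ := exists_word g
    induction w with
    | nil => exact ⟨_, [], ⟨by simp, rfl⟩, rfl⟩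
    | cons s w ih =>
      obtain ⟨n, w', hw', _⟩ := ih
      rcases s with ⟨v, a⟩
      by_cases ha : a = 1
      · subst ha
        exact ⟨_, w', ⟨hw'.1, by simp [hw'.2, ofSyl_one]⟩, rfl⟩
      · refine ⟨_, ⟨v, a⟩ :: w', ⟨?_, by simp [hw'.2]⟩, rfl⟩
        intro s hs
        rcases List.mem_cons.1 hs with rfl | hs
        · exact ha
        · exact hw'.1 s hs
  obtain ⟨w, hw, hl⟩ := Nat.find_spec hex
  refine ⟨w, ⟨⟨hw.1, rfl⟩, fun w' h' => ?_⟩, hw.2⟩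
  rw [hl]
  exact Nat.find_min' hex ⟨w', ⟨h'.1, h'.2.trans hw.2⟩, rfl⟩

theorem commute_word {v : V} (b : G v) (w : List ((v : V) × G v))
    (h : ∀ t ∈ w, Γ.Adj t.1 v) : Commute (ofSyl Γ G ⟨v, b⟩) (wordProd Γ G w) := by
  induction w with
  | nil => simp
  | cons s w ih =>
    rw [wordProd_cons]
    exact (ofSyl_comm (h s (by simp)).symm b s.2).mul_right
      (ih fun t ht => h t (by simp [ht]))

theorem word_mem {v : V} (w : List ((v : V) × G v))
    (h : ∀ t ∈ w, Γ.Adj t.1 v) : wordProd Γ G w ∈ starSub Γ G v := by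
  induction w with
  | nil => simp [one_mem]
  | cons s w ih =>
    rw [wordProd_cons]
    exact mul_mem (ofSyl_mem (Or.inr (h s (by simp)))) (ih fun t ht => h t (by simp [ht]))

open Classical in
variable (Γ G) in
/-- retraction to the star subgroup -/
noncomputable def retr (v : V) : GraphProduct Γ G →* GraphProduct Γ G :=
  gpLift Γ G (fun u => if inStar Γ v u then sylHom Γ G u else 1) (by
    intro u w a b h
    split_ifs
    · exact ofSyl_comm h a b
    · simp
    · simp
    · simp)

theorem retr_in {v : V} {s : (u : V) × G u} (h : inStar Γ v s.1) :
    retr Γ G v (ofSyl Γ G s) = ofSyl Γ G s := by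
  rcases s with ⟨u, a⟩
  unfold retr
  rw [gpLift_ofSyl, if_pos h]; rfl

theorem retr_out {v : V} {s : (u : V) × G u} (h : ¬ inStar Γ v s.1) :
    retr Γ G v (ofSyl Γ G s) = 1 := by
  rcases s with ⟨u, a⟩
  unfold retr
  rw [gpLift_ofSyl, if_neg h]; rfl

theorem retr_mem {v : V} {z : GraphProduct Γ G} (hz : z ∈ starSub Γ G v) :
    retr Γ G v z = z := by
  unfold starSub at hz
  induction hz using Subgroup.closure_induction with
  | mem x hx => obtain ⟨s, hs, rfl⟩ := hx; exact retr_in hs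
  | one => simp
  | mul x y _ _ hx hy => simp [hx, hy]
  | inv x _ hx => simp [hx]

theorem retr_word (v : V) (w : List ((v : V) × G v)) :
    ∃ (c : G v) (w' : List ((v : V) × G v)), w'.length ≤ w.length ∧ (∀ t ∈ w', Γ.Adj t.1 v) ∧
      retr Γ G v (wordProd Γ G w) = ofSyl Γ G ⟨v, c⟩ * wordProd Γ G w' := by
  induction w with
  | nil => exact ⟨1, [], by simp, by simp, by simp [ofSyl_one]⟩
  | cons s w ih =>
    obtain ⟨c, w', hl, ha, he⟩ := ih
    rcases s with ⟨u, a⟩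
    by_cases hu : u = v
    · subst hu
      refine ⟨a * c, w', by simp; omega, ha, ?_⟩
      rw [wordProd_cons, map_mul, he, retr_in (s := ⟨u, a⟩) (Or.inl rfl), ofSyl_mul, mul_assoc]
    by_cases hA : Γ.Adj u v
    · refine ⟨c, ⟨u, a⟩ :: w', by simpa using hl, ?_, ?_⟩
      · intro t ht
        rcases List.mem_cons.1 ht with rfl | ht
        · exact hA
        · exact ha t ht
      · rw [wordProd_cons, map_mul, he, retr_in (Or.inr hA), wordProd_cons, ← mul_assoc,
          ← mul_assoc, (ofSyl_comm hA a c).eq]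
    · refine ⟨c, w', by simp; omega, ha, ?_⟩
      rw [wordProd_cons, map_mul, he, retr_out (by rintro (h | h); exacts [hu h, hA h]), one_mul]

/-- A reduced word crosses each hyperplane at most once. -/
theorem Red.distinct {v : V} {a b : G v} {w1 w2 w3 : List ((v : V) × G v)}
    (h : Red Γ (w1 ++ ⟨v, a⟩ :: w2 ++ ⟨v, b⟩ :: w3)) :
    ofSyl Γ G ⟨v, a⟩ * wordProd Γ G w2 ∉ starSub Γ G v := by
  intro hm
  have hm2 := (Subgroup.mul_mem_cancel_left _ (ofSyl_mem (s := ⟨v, a⟩) (Or.inl rfl))).1 hm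
  obtain ⟨c, w', hl, ha, he⟩ := retr_word (Γ := Γ) v w2
  rw [retr_mem hm2] at he
  have := h.le (w' := w1 ++ ⟨v, a * c * b⟩ :: w' ++ w3) (by
    have := (commute_word b w' ha).eq
    simp only [wordProd_append, wordProd_cons, he, ofSyl_mul, mul_assoc]
    rw [← mul_assoc (wordProd Γ G w'), ← this]
    simp only [mul_assoc])
  simp at this
  omega

theorem Red.lab_eq {v : V} {a : G v} {w1 w2 : List ((v : V) × G v)}
    (h : Red Γ (w1 ++ ⟨v, a⟩ :: w2)) (y : GraphProduct Γ G)
    (hy : (wordProd Γ G w1)⁻¹ * y ∈ starSub Γ G v) :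
    lab v (wordProd Γ G (w1 ++ ⟨v, a⟩ :: w2)) y = a := by
  rw [lab_congr v _ _ _ hy, wordProd_append, wordProd_cons, lab_mul, lab_mul, lab_ofSyl,
    indic_same]
  have h1 : lab v (wordProd Γ G w1) (wordProd Γ G w1) = 1 := by
    by_contra hc
    obtain ⟨x, b, z, rfl, hm⟩ := lab_exists _ _ _ hc
    apply h.distinct
    simpa using hm
  have h2 : lab v (wordProd Γ G w2)
      ((ofSyl Γ G ⟨v, a⟩)⁻¹ * ((wordProd Γ G w1)⁻¹ * wordProd Γ G w1)) = 1 := by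
    by_contra hc
    obtain ⟨x, b, z, rfl, hm⟩ := lab_exists _ _ _ hc
    have h' : Red Γ (w1 ++ ⟨v, a⟩ :: x ++ ⟨v, b⟩ :: z) := by simpa using h
    apply h'.distinct
    have := inv_mem hm
    simpa using this
  rw [h1, h2]
  simp [one_mem]

theorem Red.lab_exists {u : V} {w : List ((v : V) × G v)} (hw : Red Γ w) (y : GraphProduct Γ G)
    (h : lab u (wordProd Γ G w) y ≠ 1) :
    ∃ w1 w2, w = w1 ++ ⟨u, lab u (wordProd Γ G w) y⟩ :: w2 ∧
      (wordProd Γ G w1)⁻¹ * y ∈ starSub Γ G u := by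
  obtain ⟨w1, a, w2, rfl, hm⟩ := _root_.lab_exists _ _ _ h
  refine ⟨w1, w2, ?_, hm⟩
  rw [hw.lab_eq y hm]

theorem Red.lab_prefix {u : V} {w1 w2 : List ((v : V) × G v)} (hw : Red Γ (w1 ++ w2))
    (y : GraphProduct Γ G) (h : lab u (wordProd Γ G w1) y ≠ 1) :
    lab u (wordProd Γ G (w1 ++ w2)) y = lab u (wordProd Γ G w1) y := by
  obtain ⟨a, b, e, hm⟩ := hw.left.lab_exists y h
  generalize lab u (wordProd Γ G w1) y = c at *
  subst e
  have : Red Γ (a ++ ⟨u, c⟩ :: (b ++ w2)) := by simpa using hw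
  have := this.lab_eq y hm
  simpa using this

/-- Non-adjacent syllables before a hyperplane are seen from anywhere on it. -/
theorem Red.lab_const {u v : V} {a : G v} {t : G u} {x y w2 : List ((v : V) × G v)}
    (h : Red Γ (x ++ ⟨u, t⟩ :: y ++ ⟨v, a⟩ :: w2)) (huv : ¬ Γ.Adj u v)
    (k : GraphProduct Γ G)
    (hk : (wordProd Γ G (x ++ ⟨u, t⟩ :: y))⁻¹ * k ∈ starSub Γ G v) :
    lab u k (wordProd Γ G x) = t := by
  have e : k = wordProd Γ G (x ++ ⟨u, t⟩ :: y) * ((wordProd Γ G (x ++ ⟨u, t⟩ :: y))⁻¹ * k) := by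
    group
  rw [e, lab_mul, h.left.lab_eq _ (by simp [one_mem]), lab_star huv _ hk, mul_one]
  rintro rfl hm
  apply h.distinct
  have := inv_mem hm
  simpa using this

theorem Red.shuffle {v : V} {a : G v} {w1 w2 : List ((v : V) × G v)}
    (h : Red Γ (w1 ++ ⟨v, a⟩ :: w2)) (hA : ∀ t ∈ w1, Γ.Adj t.1 v) :
    Red Γ (⟨v, a⟩ :: (w1 ++ w2)) ∧
      wordProd Γ G (⟨v, a⟩ :: (w1 ++ w2)) = wordProd Γ G (w1 ++ ⟨v, a⟩ :: w2) := by
  have e : wordProd Γ G (⟨v, a⟩ :: (w1 ++ w2)) = wordProd Γ G (w1 ++ ⟨v, a⟩ :: w2) := by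
    simp only [wordProd_append, wordProd_cons, ← mul_assoc]
    rw [(commute_word a w1 hA).eq]
  refine ⟨h.mk' e (by simp) ?_, e⟩
  intro s hs
  apply h.ne
  simp only [List.mem_cons, List.mem_append] at hs ⊢
  tauto

theorem Red.adj {v : V} {a : G v} {w1 w2 : List ((v : V) × G v)}
    (h : Red Γ (w1 ++ ⟨v, a⟩ :: w2)) (hm : wordProd Γ G w1 ∈ starSub Γ G v) :
    ∀ t ∈ w1, Γ.Adj t.1 v := by
  rintro ⟨u, t⟩ ht
  by_contra huv
  have hne : t ≠ 1 := h.ne (s := ⟨u, t⟩) (by simp [ht])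
  obtain ⟨x, y, rfl⟩ := List.append_of_mem ht
  apply hne
  rw [← h.lab_const huv 1 (by simpa using inv_mem hm), lab_one]

/-- If no hyperplane is shared, lengths are controlled. -/
theorem length_le_of_not_shared {wg w : List ((v : V) × G v)} (hg : Red Γ wg)
    (h : GraphProduct Γ G) (hw : wordProd Γ G w = h⁻¹ * wordProd Γ G wg)
    (hns : ∀ w1 v (a : G v) w2, wg = w1 ++ ⟨v, a⟩ :: w2 → lab v h (wordProd Γ G w1) ≠ a) :
    wg.length ≤ w.length := by
  have hdec : ∀ i : Fin wg.length, wg = wg.take i ++ wg[i] :: wg.drop (i + 1) := by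
    intro i; simp
  have key : ∀ i : Fin wg.length, ∃ j : Fin w.length, w[j].1 = wg[i].1 ∧
      (wordProd Γ G (w.take j))⁻¹ * (h⁻¹ * wordProd Γ G (wg.take i)) ∈
        starSub Γ G wg[i].1 := by
    intro i
    have hd := hdec i
    generalize wg[i] = s at *
    generalize wg.take i = x at *
    generalize wg.drop (i + 1) = y at *
    rcases s with ⟨v, a⟩
    have h1 := hns _ _ _ _ hd
    have h2 : lab v (wordProd Γ G w) (h⁻¹ * wordProd Γ G x) ≠ 1 := by
      rw [hw, lab_mul, lab_inv]
      rw [hd] at hg ⊢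
      simp only [inv_inv, mul_inv_cancel_left]
      rw [hg.lab_eq _ (by simp [one_mem])]
      intro hc
      exact h1 (inv_mul_eq_one.1 hc)
    obtain ⟨w1, b, w2, e, hm⟩ := lab_exists _ _ _ h2
    refine ⟨⟨w1.length, by simp [e]⟩, ?_, ?_⟩
    · simp [e]
    · simpa [e] using hm
  choose f hf1 hf2 using key
  have inj : ∀ i j : Fin wg.length, i < j → f i ≠ f j := by
    intro i j hij hfe
    have e1 := hf1 i
    have e2 := hf1 j
    have m1 := hf2 i
    have m2 := hf2 j
    rw [hfe] at e1 m1
    have hv : wg[i].1 = wg[j].1 := e1.symm.trans e2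
    have hd : ∃ b, wg.take j = wg.take i ++ wg[i] :: b := by
      refine ⟨(wg.take j).drop (i + 1), ?_⟩
      have hi : (i : ℕ) < (wg.take j).length := by simp; omega
      have := List.take_append_drop i (wg.take j)
      rw [List.drop_eq_getElem_cons hi] at this
      rw [List.take_take, min_eq_left (by omega)] at this
      simpa using this.symm
    obtain ⟨b, hb⟩ := hd
    have hd := hdec j
    rw [hb] at hd m2
    generalize wg[i] = s at *
    generalize wg[j] = t at *
    rcases s with ⟨v, a⟩
    rcases t with ⟨v', a'⟩
    simp only at hv
    subst hv
    rw [hd] at hg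
    apply hg.distinct
    have := mul_mem (inv_mem m1) m2
    simpa [mul_assoc] using this
  have := Fintype.card_le_of_injective f (by
    intro i j hij
    by_contra hne
    rcases lt_or_gt_of_ne hne with hl | hl
    · exact inj i j hl hij
    · exact inj j i hl hij.symm)
  simpa using this

theorem tail_main (n : ℕ) : ∀ (wg wh w : List ((v : V) × G v)), wg.length = n →
    Red Γ wg → Red Γ wh → wordProd Γ G w = (wordProd Γ G wh)⁻¹ * wordProd Γ G wg →
    ∀ (v : V) (y : GraphProduct Γ G), lab v (wordProd Γ G wg) y ≠ 1 →
      lab v (wordProd Γ G wg) y ≠ lab v (wordProd Γ G wh) y →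
      ∃ w', Red Γ w' ∧ wordProd Γ G w' = wordProd Γ G wg ∧
        (⟨v, lab v (wordProd Γ G wg) y⟩ : (v : V) × G v) ∈ w'.drop (w'.length - w.length) := by
  classical
  induction n with
  | zero =>
    intro wg wh w hn hg hh hw v y h1 h2
    have : wg = [] := List.length_eq_zero_iff.1 hn
    subst this
    simp [lab_one] at h1
  | succ n ih =>
    intro wg wh w hn hg hh hw v y h1 h2
    by_cases hs : ∃ k w1 u, ∃ a : G u, ∃ w2, wg = w1 ++ ⟨u, a⟩ :: w2 ∧
        lab u (wordProd Γ G wh) (wordProd Γ G w1) = a ∧ w1.length = k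
    · obtain ⟨w1, u, a, w2, e, hl, hk⟩ := Nat.find_spec hs
      have hmin := fun m hm => Nat.find_min hs (m := m) hm
      rw [← hk] at hmin
      subst e
      have ha1 : a ≠ 1 := hg.ne (s := ⟨u, a⟩) (by simp)
      obtain ⟨x1, x2, e, hm⟩ := hh.lab_exists (wordProd Γ G w1) (by rw [hl]; exact ha1)
      rw [hl] at e
      have hA : ∀ t ∈ w1, Γ.Adj t.1 u := by
        rintro ⟨p, t⟩ ht
        by_contra hpu
        have hne : t ≠ 1 := hg.ne (s := ⟨p, t⟩) (by simp [ht])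
        obtain ⟨b, c, rfl⟩ := List.append_of_mem ht
        have hc := hg.lab_const hpu (wordProd Γ G x1) (by simpa using inv_mem hm)
        refine hmin b.length (by simp) ⟨b, p, t, c ++ ⟨u, a⟩ :: w2, by simp, ?_, rfl⟩
        rw [e] at hh ⊢
        rw [hh.lab_prefix _ (by rw [hc]; exact hne), hc]
      have hw1 := word_mem w1 hA
      have hx1 : wordProd Γ G x1 ∈ starSub Γ G u := by
        have := (Subgroup.mul_mem_cancel_right _ hw1).1 hm
        simpa using this
      subst e
      have hA' := hh.adj hx1
      obtain ⟨rg, eg⟩ := hg.shuffle hA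
      obtain ⟨rh, eh⟩ := hh.shuffle hA'
      rw [← eg, ← eh] at hw h2
      rw [← eg] at h1 ⊢
      have hlen : (w1 ++ w2).length = n := by simp at hn ⊢; omega
      generalize w1 ++ w2 = g1 at *
      generalize x1 ++ x2 = h1' at *
      have hone : lab v (ofSyl Γ G ⟨u, a⟩) y = 1 := by
        rw [lab_ofSyl]
        by_cases huv : u = v
        · subst huv
          rw [indic_same, if_neg]
          intro hy
          apply h2
          have r1 : Red Γ ([] ++ ⟨u, a⟩ :: g1) := rg
          have r2 : Red Γ ([] ++ ⟨u, a⟩ :: h1') := rh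
          have q1 := r1.lab_eq y (by simpa using hy)
          have q2 := r2.lab_eq y (by simpa using hy)
          simp only [List.nil_append] at q1 q2
          rw [q1, q2]
        · exact indic_ne huv _ _
      have lg : lab v (wordProd Γ G (⟨u, a⟩ :: g1)) y =
          lab v (wordProd Γ G g1) ((ofSyl Γ G ⟨u, a⟩)⁻¹ * y) := by
        rw [wordProd_cons, lab_mul, hone, one_mul]
      have lh : lab v (wordProd Γ G (⟨u, a⟩ :: h1')) y =
          lab v (wordProd Γ G h1') ((ofSyl Γ G ⟨u, a⟩)⁻¹ * y) := by
        rw [wordProd_cons, lab_mul, hone, one_mul]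
      rw [lg, lh] at h2
      rw [lg] at h1 ⊢
      have rg1 : Red Γ g1 := Red.right (a := [⟨u, a⟩]) rg
      have rh1 : Red Γ h1' := Red.right (a := [⟨u, a⟩]) rh
      obtain ⟨w', r', e', m'⟩ := ih g1 h1' w hlen rg1 rh1
        (by rw [hw]; simp) v _ h1 h2
      refine ⟨⟨u, a⟩ :: w', rg.mk' (by simp [e']) ?_ ?_, by simp [e'], ?_⟩
      · simpa using r'.le e'.symm
      · intro s hs
        rcases List.mem_cons.1 hs with rfl | hs
        · exact ha1
        · exact r'.ne hs
      · have : (w'.drop (w'.length - w.length)) <:+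
            ((⟨u, a⟩ :: w').drop ((⟨u, a⟩ :: w' : List ((v : V) × G v)).length - w.length)) := by
          by_cases hc : w.length ≤ w'.length
          · have : (⟨u, a⟩ :: w' : List ((v : V) × G v)).length - w.length
                = (w'.length - w.length) + 1 := by simp; omega
            rw [this, List.drop_succ_cons]
          · have : (⟨u, a⟩ :: w' : List ((v : V) × G v)).length - w.length = 0 := by
              simp; omega
            rw [this, List.drop_zero]
            exact (List.drop_suffix _ _).trans (List.suffix_cons _ _)
        exact this.subset m'
    · refine ⟨wg, hg, rfl, ?_⟩
      have := length_le_of_not_shared hg _ hw (fun w1 u a w2 e hl =>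
        hs ⟨_, w1, u, a, w2, e, hl, rfl⟩)
      rw [Nat.sub_eq_zero_of_le this, List.drop_zero]
      obtain ⟨x, z, e, _⟩ := hg.lab_exists y h1
      generalize lab v (wordProd Γ G wg) y = c at *
      rw [e]; simp

theorem redLength_eq {w : List ((v : V) × G v)} {g : GraphProduct Γ G}
    (hw : IsReducedWordOf Γ G w g) : redLength Γ G g = w.length := by
  apply le_antisymm
  · exact Nat.sInf_le ⟨w, hw.1, rfl⟩
  · refine le_csInf (s := {n | ∃ w, IsWordOf Γ G w g ∧ w.length = n}) ⟨_, w, hw.1, rfl⟩ ?_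
    rintro n ⟨w', h', rfl⟩
    exact hw.2 w' h'

theorem tail_lab (g h : GraphProduct Γ G) (w : List ((v : V) × G v))
    (hw : wordProd Γ G w = h⁻¹ * g) (v : V) (y : GraphProduct Γ G) (h1 : lab v g y ≠ 1)
    (h2 : lab v g y ≠ lab v h y) :
    (⟨v, lab v g y⟩ : (v : V) × G v) ∈ dTail Γ G g w.length := by
  obtain ⟨wg, rg, rfl⟩ := exists_red g
  obtain ⟨wh, rh, rfl⟩ := exists_red h
  obtain ⟨w', r', e', m'⟩ := tail_main _ wg wh w rfl rg rh hw v y h1 h2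
  exact ⟨w', e' ▸ r', m'⟩

theorem exists_inv_word (w : List ((v : V) × G v)) :
    ∃ w', wordProd Γ G w' = (wordProd Γ G w)⁻¹ ∧ w'.length = w.length := by
  induction w with
  | nil => exact ⟨[], by simp, rfl⟩
  | cons s w ih =>
    obtain ⟨w', e, hl⟩ := ih
    exact ⟨w' ++ [⟨s.1, s.2⁻¹⟩], by simp [e, ofSyl_inv], by simp [hl]⟩

end Helpers

section Statements

variable {V : Type} [Fintype V] (Γ : SimpleGraph V) (G : V → Type) [∀ v, Group (G v)]

theorem stmt4 (g h : GraphProduct Γ G) (w : List ((v : V) × G v))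
    (hw : IsReducedWordOf Γ G w (h⁻¹ * g)) :
    ∀ s ∈ w,
      s ∈ dTail Γ G g (redLength Γ G (h⁻¹ * g)) ∨
      (∃ t ∈ dTail Γ G h (redLength Γ G (h⁻¹ * g)), s = ⟨t.1, t.2⁻¹⟩) ∨
      (∃ t ∈ dTail Γ G h (redLength Γ G (h⁻¹ * g)),
        ∃ u ∈ dTail Γ G g (redLength Γ G (h⁻¹ * g)),
        ∃ hv : t.1 = u.1, s = ⟨u.1, (cast (congrArg G hv) t.2)⁻¹ * u.2⟩) := by
  rintro ⟨v, a⟩ hs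
  rw [redLength_eq hw]
  have e : wordProd Γ G w = h⁻¹ * g := hw.1.2
  have hr : Red Γ w := by unfold Red; rw [e]; exact hw
  have ha : a ≠ 1 := hr.ne hs
  obtain ⟨w', e', hl⟩ := exists_inv_word (Γ := Γ) w
  rw [e, mul_inv_rev, inv_inv] at e'
  obtain ⟨x, z, hx⟩ := List.append_of_mem hs
  have key : a = (lab v h (h * wordProd Γ G x))⁻¹ * lab v g (h * wordProd Γ G x) := by
    have h1 : lab v (wordProd Γ G w) (wordProd Γ G x) = a := by
      rw [hx] at hr ⊢
      exact hr.lab_eq _ (by simp [one_mem])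
    rw [e, lab_mul, lab_inv, inv_inv] at h1
    exact h1.symm
  generalize h * wordProd Γ G x = y at *
  have hne : lab v g y ≠ lab v h y := by
    intro hc
    rw [hc, inv_mul_cancel] at key
    exact ha key
  have tg := fun h1 => tail_lab g h w e v y h1 hne
  have th := fun h1 => tail_lab h g w' e' v y h1 hne.symm
  rw [hl] at th
  by_cases hh1 : lab v h y = 1
  · left
    rw [hh1, inv_one, one_mul] at key
    rw [key]
    exact tg (key ▸ ha)
  · right
    by_cases hg1 : lab v g y = 1
    · left
      refine ⟨_, th hh1, ?_⟩
      rw [key, hg1, mul_one]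
    · right
      refine ⟨_, th hh1, _, tg hg1, rfl, ?_⟩
      rw [key]; rfl

end Statements
end

section
/- Let v ∈ Γ and k ∈ G(Γ). (a) Among all h ∈ G(Γ) with h𝔸_v = k𝔸_v there is a unique element of minimal reduced word length |·|_r. (b) If w ∈ Γ is equal to v or not adjacent to v, and k is this minimal representative of its wall, then the walls k𝔸_v and 𝔸_w are parallel (they do not cross). -/
open scoped ComplexOrder commutatorElement

namespace GP

open Classical in
/-- exposed syllable at `v` -/
noncomputable def sg {V : Type} (Γ : SimpleGraph V) (G : V → Type) [∀ v, Group (G v)] (v : V) :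
    List ((v : V) × G v) → G v
  | [] => 1
  | s :: l => if h : s.1 = v then h ▸ s.2 else if Γ.Adj s.1 v then sg Γ G v l else 1

open Classical in
/-- remove exposed syllable at `v` -/
noncomputable def rst {V : Type} (Γ : SimpleGraph V) (G : V → Type) [∀ v, Group (G v)] (v : V) :
    List ((v : V) × G v) → List ((v : V) × G v)
  | [] => []
  | s :: l => if s.1 = v then l else if Γ.Adj s.1 v then s :: rst Γ G v l else s :: l

/-- combinatorially reduced -/
def Rd {V : Type} (Γ : SimpleGraph V) (G : V → Type) [∀ v, Group (G v)] :
    List ((v : V) × G v) → Prop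
  | [] => True
  | s :: l => s.2 ≠ 1 ∧ sg Γ G s.1 l = 1 ∧ Rd Γ G l

/-- shuffle equivalence -/
inductive Sh {V : Type} (Γ : SimpleGraph V) (G : V → Type) :
    List ((v : V) × G v) → List ((v : V) × G v) → Prop
  | refl (l) : Sh Γ G l l
  | swap (s t l) : Γ.Adj s.1 t.1 → Sh Γ G (s :: t :: l) (t :: s :: l)
  | cons (s l l') : Sh Γ G l l' → Sh Γ G (s :: l) (s :: l')
  | trans (l l' l'') : Sh Γ G l l' → Sh Γ G l' l'' → Sh Γ G l l''

section
variable {V : Type} {Γ : SimpleGraph V} {G : V → Type} [∀ v, Group (G v)]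

@[simp] lemma sg_nil (v : V) : sg Γ G v [] = 1 := by simp [sg]
@[simp] lemma rst_nil (v : V) : rst Γ G v [] = [] := by simp [rst]
@[simp] lemma sg_self (v : V) (a : G v) (l) : sg Γ G v (⟨v, a⟩ :: l) = a := by simp [sg]
@[simp] lemma rst_self (v : V) (a : G v) (l) : rst Γ G v (⟨v, a⟩ :: l) = l := by simp [rst]
lemma sg_adj {u v : V} (h : Γ.Adj u v) (a : G u) (l) :
    sg Γ G v (⟨u, a⟩ :: l) = sg Γ G v l := by simp [sg, h, h.ne]
lemma rst_adj {u v : V} (h : Γ.Adj u v) (a : G u) (l) :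
    rst Γ G v (⟨u, a⟩ :: l) = ⟨u, a⟩ :: rst Γ G v l := by simp [rst, h, h.ne]
lemma sg_non {u v : V} (h : ¬ Γ.Adj u v) (h' : u ≠ v) (a : G u) (l) :
    sg Γ G v (⟨u, a⟩ :: l) = 1 := by simp [sg, h, h']
lemma rst_non {u v : V} (h : ¬ Γ.Adj u v) (h' : u ≠ v) (a : G u) (l) :
    rst Γ G v (⟨u, a⟩ :: l) = ⟨u, a⟩ :: l := by simp [rst, h, h']

lemma tri (Γ : SimpleGraph V) (u v : V) : u = v ∨ (Γ.Adj u v) ∨ (¬ Γ.Adj u v ∧ u ≠ v) := by tauto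

lemma sg_rst (v : V) (l) (hl : Rd Γ G l) : sg Γ G v (rst Γ G v l) = 1 := by
  induction l with
  | nil => simp
  | cons s l ih =>
    obtain ⟨u, b⟩ := s
    obtain ⟨h1, h2, h3⟩ := hl
    rcases tri Γ u v with rfl | h | ⟨h, h'⟩
    · simpa using h2
    · rw [rst_adj h, sg_adj h, ih h3]
    · rw [rst_non h h', sg_non h h']

lemma rst_of_sg (v : V) (l) (hl : Rd Γ G l) (hs : sg Γ G v l = 1) : rst Γ G v l = l := by
  induction l with
  | nil => simp
  | cons s l ih =>
    obtain ⟨u, b⟩ := s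
    obtain ⟨h1, h2, h3⟩ := hl
    rcases tri Γ u v with rfl | h | ⟨h, h'⟩
    · simp at hs; exact absurd hs h1
    · rw [sg_adj h] at hs; rw [rst_adj h, ih h3 hs]
    · rw [rst_non h h']

lemma sg_rst_adj {u v : V} (huv : Γ.Adj u v) (l) : sg Γ G u (rst Γ G v l) = sg Γ G u l := by
  induction l with
  | nil => simp
  | cons s l ih =>
    obtain ⟨t, b⟩ := s
    rcases tri Γ t v with rfl | h | ⟨h, h'⟩
    · rw [rst_self, sg_adj huv.symm]
    · rw [rst_adj h]
      rcases tri Γ t u with rfl | k | ⟨k, k'⟩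
      · simp
      · rw [sg_adj k, sg_adj k, ih]
      · rw [sg_non k k', sg_non k k']
    · rw [rst_non h h']

lemma rd_rst (v : V) (l) (hl : Rd Γ G l) : Rd Γ G (rst Γ G v l) := by
  induction l with
  | nil => simpa
  | cons s l ih =>
    have hl' := hl
    obtain ⟨u, b⟩ := s
    obtain ⟨h1, h2, h3⟩ := hl
    rcases tri Γ u v with rfl | h | ⟨h, h'⟩
    · simpa
    · rw [rst_adj h]
      refine ⟨h1, ?_, ih h3⟩
      simpa [sg_rst_adj h] using h2
    · rw [rst_non h h']; exact hl'

lemma sh_rst (v : V) (l) (hs : sg Γ G v l ≠ 1) :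
    Sh Γ G (⟨v, sg Γ G v l⟩ :: rst Γ G v l) l := by
  induction l with
  | nil => simp at hs
  | cons s l ih =>
    obtain ⟨u, b⟩ := s
    rcases tri Γ u v with rfl | h | ⟨h, h'⟩
    · simpa using Sh.refl _
    · rw [sg_adj h] at hs ⊢
      rw [rst_adj h]
      exact (Sh.swap _ _ _ h.symm).trans _ _ _ (Sh.cons _ _ _ (ih hs))
    · rw [sg_non h h'] at hs; exact absurd rfl hs

lemma rst_comm {u v : V} (huv : Γ.Adj u v) (l) :
    rst Γ G u (rst Γ G v l) = rst Γ G v (rst Γ G u l) := by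
  induction l with
  | nil => simp
  | cons s l ih =>
    obtain ⟨t, b⟩ := s
    rcases tri Γ t v with rfl | h | ⟨h, h'⟩
    · rw [rst_self, rst_adj huv.symm, rst_self]
    · rw [rst_adj h]
      rcases tri Γ t u with rfl | k | ⟨k, k'⟩
      · simp
      · rw [rst_adj k, rst_adj k, rst_adj h, ih]
      · rw [rst_non k k', rst_non k k', rst_adj h]
    · rw [rst_non h h']
      rcases tri Γ t u with rfl | k | ⟨k, k'⟩
      · exact absurd huv h
      · rw [rst_adj k, rst_non h h']
      · rw [rst_non k k', rst_non h h']

set_option linter.unusedSectionVars false in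
lemma Sh.symm {l l'} (h : Sh Γ G l l') : Sh Γ G l' l := by
  induction h with
  | refl l => exact .refl _
  | swap s t l h => exact .swap _ _ _ h.symm
  | cons s l l' _ ih => exact .cons _ _ _ ih
  | trans l l' l'' _ _ i1 i2 => exact i2.trans _ _ _ i1

lemma sg_congr (v : V) {l l'} (h : Sh Γ G l l') : sg Γ G v l = sg Γ G v l' := by
  induction h with
  | refl l => rfl
  | swap s t l h =>
    obtain ⟨s, a⟩ := s
    obtain ⟨t, b⟩ := t
    simp only at h
    rcases tri Γ s v with rfl | k | ⟨k, k'⟩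
    · rw [sg_self, sg_adj h.symm, sg_self]
    · rw [sg_adj k]
      rcases tri Γ t v with rfl | m | ⟨m, m'⟩
      · simp
      · rw [sg_adj m, sg_adj m, sg_adj k]
      · rw [sg_non m m', sg_non m m']
    · rw [sg_non k k']
      rcases tri Γ t v with rfl | m | ⟨m, m'⟩
      · exact absurd h k
      · rw [sg_adj m, sg_non k k']
      · rw [sg_non m m']
  | cons s l l' _ ih => simp only [sg, ih]
  | trans l l' l'' _ _ i1 i2 => exact i1.trans i2

lemma rst_congr (v : V) {l l'} (h : Sh Γ G l l') : Sh Γ G (rst Γ G v l) (rst Γ G v l') := by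
  induction h with
  | refl l => exact .refl _
  | swap s t l h =>
    obtain ⟨s, a⟩ := s
    obtain ⟨t, b⟩ := t
    simp only at h
    rcases tri Γ s v with rfl | k | ⟨k, k'⟩
    · rw [rst_self, rst_adj h.symm, rst_self]; exact .refl _
    · rw [rst_adj k]
      rcases tri Γ t v with rfl | m | ⟨m, m'⟩
      · simpa using Sh.refl _
      · rw [rst_adj m, rst_adj m, rst_adj k]; exact .swap _ _ _ h
      · rw [rst_non m m', rst_non m m']; exact .swap _ _ _ h
    · rw [rst_non k k']
      rcases tri Γ t v with rfl | m | ⟨m, m'⟩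
      · exact absurd h k
      · rw [rst_adj m, rst_non k k']; exact .swap _ _ _ h
      · rw [rst_non m m']; exact .swap _ _ _ h
  | cons s l l' hh ih =>
    obtain ⟨s, a⟩ := s
    rcases tri Γ s v with rfl | k | ⟨k, k'⟩
    · simpa
    · rw [rst_adj k, rst_adj k]; exact .cons _ _ _ ih
    · rw [rst_non k k', rst_non k k']; exact .cons _ _ _ hh
  | trans l l' l'' _ _ i1 i2 => exact i1.trans _ _ _ i2

open Classical in
/-- list level action -/
noncomputable def actL (Γ : SimpleGraph V) (v : V) (a : G v) (l : List ((v : V) × G v)) :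
    List ((v : V) × G v) :=
  if a * sg Γ G v l = 1 then rst Γ G v l else ⟨v, a * sg Γ G v l⟩ :: rst Γ G v l

lemma rd_actL (v : V) (a : G v) (l) (hl : Rd Γ G l) : Rd Γ G (actL Γ v a l) := by
  unfold actL
  split_ifs with h
  · exact rd_rst v l hl
  · exact ⟨h, sg_rst v l hl, rd_rst v l hl⟩

lemma sg_actL (v : V) (a : G v) (l) (hl : Rd Γ G l) : sg Γ G v (actL Γ v a l) = a * sg Γ G v l := by
  unfold actL
  split_ifs with h
  · rw [h, sg_rst v l hl]
  · simp

lemma rst_actL (v : V) (a : G v) (l) (hl : Rd Γ G l) : rst Γ G v (actL Γ v a l) = rst Γ G v l := by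
  unfold actL
  split_ifs with h
  · exact rst_of_sg _ _ (rd_rst v l hl) (sg_rst v l hl)
  · simp

lemma sg_actL_adj {u v : V} (h : Γ.Adj v u) (a : G v) (l) :
    sg Γ G u (actL Γ v a l) = sg Γ G u l := by
  unfold actL
  split_ifs
  · exact sg_rst_adj h.symm l
  · rw [sg_adj h, sg_rst_adj h.symm l]

lemma actL_congr (v : V) (a : G v) {l l'} (h : Sh Γ G l l') :
    Sh Γ G (actL Γ v a l) (actL Γ v a l') := by
  unfold actL
  rw [sg_congr v h]
  split_ifs
  · exact rst_congr v h
  · exact .cons _ _ _ (rst_congr v h)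

lemma actL_one (v : V) (l) (hl : Rd Γ G l) : Sh Γ G (actL Γ v 1 l) l := by
  unfold actL
  rw [one_mul]
  split_ifs with h
  · rw [rst_of_sg v l hl h]; exact .refl _
  · exact sh_rst v l h

lemma actL_mul (v : V) (a b : G v) (l) (hl : Rd Γ G l) :
    actL Γ v (a * b) l = actL Γ v a (actL Γ v b l) := by
  rw [actL.eq_def Γ v a (actL Γ v b l), sg_actL v b l hl, rst_actL v b l hl, ← mul_assoc]
  rfl

lemma actL_comm {u v : V} (h : Γ.Adj u v) (a : G u) (b : G v) (l) :
    Sh Γ G (actL Γ u a (actL Γ v b l)) (actL Γ v b (actL Γ u a l)) := by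
  rw [actL, sg_actL_adj h.symm, actL.eq_def Γ v b (actL Γ u a l), sg_actL_adj h]
  unfold actL
  split_ifs
  · rw [rst_comm h]; exact .refl _
  · rw [rst_adj h.symm, rst_comm h]; exact .refl _
  · rw [rst_adj h, rst_comm h]; exact .refl _
  · rw [rst_adj h, rst_adj h.symm, rst_comm h]; exact .swap _ _ _ h

variable (Γ G) in
/-- setoid of shuffles on reduced lists -/
def shSetoid : Setoid {l : List ((v : V) × G v) // Rd Γ G l} where
  r x y := Sh Γ G x.1 y.1
  iseqv := ⟨fun _ => .refl _, fun h => h.symm, fun h k => h.trans _ _ _ k⟩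

variable (Γ G) in
/-- normal forms -/
abbrev NF := Quotient (shSetoid Γ G)

/-- action on normal forms -/
noncomputable def actX (v : V) : G v →* Function.End (NF Γ G) where
  toFun a := Quotient.map (fun x => ⟨actL Γ v a x.1, rd_actL v a x.1 x.2⟩)
    (fun _ _ h => actL_congr v a h)
  map_one' := by
    funext x
    induction x using Quotient.inductionOn with
    | h x => exact Quotient.sound (actL_one v x.1 x.2)
  map_mul' a b := by
    funext x
    induction x using Quotient.inductionOn with
    | h x =>
      apply Quotient.sound
      change Sh Γ G (actL Γ v (a * b) x.1) (actL Γ v a (actL Γ v b x.1))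
      rw [actL_mul v a b x.1 x.2]
      exact .refl _

lemma actX_comm {u v : V} (h : Γ.Adj u v) (a : G u) (b : G v) :
    actX (Γ := Γ) u a * actX v b = actX v b * actX u a := by
  funext x
  induction x using Quotient.inductionOn with
  | h x => exact Quotient.sound (actL_comm h a b x.1)

variable (Γ G) in
/-- permutation representation of the free product -/
noncomputable def rep0 : Monoid.CoprodI G →* Equiv.Perm (NF Γ G) :=
  Monoid.CoprodI.lift (fun v => (actX (Γ := Γ) v).toHomPerm)

lemma rep0_rel : Subgroup.normalClosure (commRels Γ G) ≤ (rep0 Γ G).ker := by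
  apply Subgroup.normalClosure_le_normal
  rintro x ⟨u, v, a, b, h, rfl⟩
  change rep0 Γ G _ = 1
  rw [map_commutatorElement, commutatorElement_eq_one_iff_mul_comm]
  simp only [rep0, Monoid.CoprodI.lift_of]
  ext x
  exact congrFun (actX_comm h a b) x

variable (Γ G) in
/-- permutation representation of the graph product -/
noncomputable def rep : GraphProduct Γ G →* Equiv.Perm (NF Γ G) :=
  QuotientGroup.lift _ (rep0 Γ G) rep0_rel

/-- abbreviation -/
abbrev oS (Γ : SimpleGraph V) {v : V} (a : G v) : GraphProduct Γ G := ofSyl Γ G ⟨v, a⟩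

lemma rep_of (v : V) (a : G v) (x) : rep Γ G (oS Γ a) x = actX v a x := by
  have : rep Γ G (oS Γ a) = rep0 Γ G (Monoid.CoprodI.of a) := rfl
  rw [this, rep0, Monoid.CoprodI.lift_of]
  rfl

/-- exposed syllable on normal forms -/
noncomputable def sgX (v : V) : NF Γ G → G v :=
  Quotient.lift (fun x => sg Γ G v x.1) (fun _ _ h => sg_congr v h)

/-- exposed syllable on the group -/
noncomputable def S (v : V) (g : GraphProduct Γ G) : G v :=
  sgX v (rep Γ G g (Quotient.mk _ ⟨[], trivial⟩))

lemma S_one (v : V) : S v (1 : GraphProduct Γ G) = 1 := by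
  simp [S, sgX]

lemma S_mul (v : V) (a : G v) (g : GraphProduct Γ G) : S v (oS Γ a * g) = a * S v g := by
  unfold S
  rw [map_mul, Equiv.Perm.mul_apply, rep_of]
  induction rep Γ G g (Quotient.mk _ ⟨[], trivial⟩) using Quotient.inductionOn with
  | h x => exact sg_actL v a x.1 x.2

lemma S_adj {u v : V} (h : Γ.Adj u v) (a : G u) (g : GraphProduct Γ G) :
    S v (oS Γ a * g) = S v g := by
  unfold S
  rw [map_mul, Equiv.Perm.mul_apply, rep_of]
  induction rep Γ G g (Quotient.mk _ ⟨[], trivial⟩) using Quotient.inductionOn with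
  | h x => exact sg_actL_adj h a x.1

lemma S_non {u v : V} (h : ¬ Γ.Adj u v) (h' : u ≠ v) (a : G u) (ha : a ≠ 1)
    (g : GraphProduct Γ G) (hg : S u g = 1) : S v (oS Γ a * g) = 1 := by
  unfold S at *
  rw [map_mul, Equiv.Perm.mul_apply, rep_of]
  generalize rep Γ G g (Quotient.mk _ ⟨[], trivial⟩) = y at *
  induction y using Quotient.inductionOn with
  | h x =>
    change sg Γ G u x.1 = 1 at hg
    change sg Γ G v (actL Γ u a x.1) = 1
    rw [actL, hg, mul_one, if_neg ha, sg_non h h']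

@[simp] lemma P_nil : wordProd Γ G [] = 1 := rfl
@[simp] lemma P_cons (s) (l) : wordProd Γ G (s :: l) = ofSyl Γ G s * wordProd Γ G l := by
  simp [wordProd]
@[simp] lemma P_append (l m) : wordProd Γ G (l ++ m) = wordProd Γ G l * wordProd Γ G m := by
  simp [wordProd]

lemma oS_one (v : V) : oS Γ (1 : G v) = 1 := by
  unfold oS ofSyl; simp
lemma oS_mul {v : V} (a b : G v) : oS Γ (a * b) = oS Γ a * oS Γ b := by
  unfold oS ofSyl; simp
lemma oS_inv {v : V} (a : G v) : oS Γ (a⁻¹) = (oS Γ a)⁻¹ := by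
  unfold oS ofSyl; simp

lemma oS_comm {u v : V} (h : Γ.Adj u v) (a : G u) (b : G v) :
    oS Γ a * oS Γ b = oS Γ b * oS Γ a := by
  rw [← commutatorElement_eq_one_iff_mul_comm]
  have : (⁅Monoid.CoprodI.of a, Monoid.CoprodI.of b⁆ : Monoid.CoprodI G) ∈
      Subgroup.normalClosure (commRels Γ G) :=
    Subgroup.subset_normalClosure ⟨u, v, a, b, h, rfl⟩
  exact (QuotientGroup.eq_one_iff _).2 this

lemma filt (w : List ((v : V) × G v)) : ∃ w', IsWordOf Γ G w' (wordProd Γ G w) ∧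
    w'.length ≤ w.length := by
  induction w with
  | nil => exact ⟨[], ⟨by simp, rfl⟩, le_rfl⟩
  | cons s l ih =>
    obtain ⟨w, ⟨h1, h2⟩, h3⟩ := ih
    obtain ⟨v, a⟩ := s
    by_cases ha : a = 1
    · subst ha
      refine ⟨w, ⟨h1, ?_⟩, by simp; omega⟩
      rw [P_cons, h2]
      change _ = oS Γ (1 : G v) * _
      rw [oS_one, one_mul]
    · refine ⟨⟨v, a⟩ :: w, ⟨?_, by simp [h2]⟩, by simpa⟩
      intro s hs
      rcases List.mem_cons.1 hs with rfl | hs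
      · exact ha
      · exact h1 s hs

lemma len_le {w} {g : GraphProduct Γ G} (h : wordProd Γ G w = g) : redLength Γ G g ≤ w.length := by
  obtain ⟨w', h1, h2⟩ := filt (Γ := Γ) w
  rw [h] at h1
  have h3 : redLength Γ G g ≤ w'.length := Nat.sInf_le ⟨w', h1, rfl⟩
  exact h3.trans h2

lemma exists_word (g : GraphProduct Γ G) : ∃ w, wordProd Γ G w = g := by
  obtain ⟨x, rfl⟩ := QuotientGroup.mk_surjective g
  induction x using Monoid.CoprodI.induction_on with
  | one => exact Exists.intro [] rfl
  | of v a => exact ⟨[(⟨v, a⟩ : (v : V) × G v)], by rw [P_cons, P_nil, mul_one]; rfl⟩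
  | mul x y hx hy =>
    obtain ⟨a, ha⟩ := hx
    obtain ⟨b, hb⟩ := hy
    refine ⟨a ++ b, ?_⟩
    rw [P_append, ha, hb]; rfl

lemma exists_geo (g : GraphProduct Γ G) : ∃ w, wordProd Γ G w = g ∧ redLength Γ G g = w.length := by
  obtain ⟨w, hw⟩ := exists_word g
  obtain ⟨w', h1, h2⟩ := filt (Γ := Γ) w
  rw [hw] at h1
  obtain ⟨x, hx, hx'⟩ := Nat.sInf_mem
    (s := {n | ∃ w, IsWordOf Γ G w g ∧ w.length = n}) ⟨_, w', h1, rfl⟩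
  exact ⟨x, hx.2, hx'.symm⟩

lemma len_one : redLength Γ G 1 = 0 := Nat.le_zero.1 (len_le (w := []) rfl)

lemma len_zero {g : GraphProduct Γ G} (h : redLength Γ G g = 0) : g = 1 := by
  obtain ⟨w, h1, h2⟩ := exists_geo g
  rw [h] at h2
  rw [← h1, List.length_eq_zero_iff.1 h2.symm]; rfl

lemma len_mul_le (g h : GraphProduct Γ G) :
    redLength Γ G (g * h) ≤ redLength Γ G g + redLength Γ G h := by
  obtain ⟨w, h1, h2⟩ := exists_geo g
  obtain ⟨x, h3, h4⟩ := exists_geo h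
  rw [h2, h4, ← List.length_append]
  exact len_le (by simp [h1, h3])

lemma len_oS {v : V} (a : G v) : redLength Γ G (oS Γ a) ≤ 1 :=
  len_le (w := [⟨v, a⟩]) (by simp)

lemma len_inv_le (g : GraphProduct Γ G) : redLength Γ G g⁻¹ ≤ redLength Γ G g := by
  obtain ⟨w, h1, h2⟩ := exists_geo g
  rw [h2, ← h1]
  clear h1 h2
  induction w with
  | nil => simp [len_one]
  | cons s l ih =>
    obtain ⟨v, a⟩ := s
    rw [P_cons, mul_inv_rev]
    refine (len_mul_le _ _).trans ?_
    have := len_oS (Γ := Γ) a⁻¹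
    rw [oS_inv] at this
    unfold oS at this
    simp only [List.length_cons]
    omega

lemma len_inv (g : GraphProduct Γ G) : redLength Γ G g⁻¹ = redLength Γ G g := by
  refine le_antisymm (len_inv_le g) ?_
  simpa using len_inv_le g⁻¹

lemma drop_word (n : ℕ) : ∀ (l : List ((v : V) × G v)), l.length ≤ n → ∀ v : V,
    S v (wordProd Γ G l) ≠ 1 →
    ∃ l', wordProd Γ G l' = oS Γ (S v (wordProd Γ G l))⁻¹ * wordProd Γ G l ∧
      l'.length < l.length := by
  induction n with
  | zero =>
    intro l hl v hv
    rw [List.length_eq_zero_iff.1 (Nat.le_zero.1 hl), P_nil, S_one] at hv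
    exact absurd rfl hv
  | succ n ih =>
    intro l hl v hv
    rcases l with _ | ⟨⟨u, b⟩, m⟩
    · rw [P_nil, S_one] at hv
      exact absurd rfl hv
    · have hm : m.length ≤ n := by simpa using hl
      have hP : wordProd Γ G (⟨u, b⟩ :: m) = oS Γ b * wordProd Γ G m := P_cons _ _
      rw [hP] at hv ⊢
      rcases tri Γ u v with rfl | h | ⟨h, h'⟩
      · rw [S_mul] at hv ⊢
        by_cases hs : S u (wordProd Γ G m) = 1
        · exact ⟨m, by rw [hs, mul_one, oS_inv, inv_mul_cancel_left], by simp⟩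
        · obtain ⟨l', h1, h2⟩ := ih m hm u hs
          refine ⟨l', ?_, by simp; omega⟩
          rw [h1, mul_inv_rev, oS_mul, oS_inv b]
          group
      · rw [S_adj h] at hv ⊢
        obtain ⟨l', h1, h2⟩ := ih m hm v hv
        refine ⟨⟨u, b⟩ :: l', ?_, by simpa⟩
        rw [P_cons, h1, ← mul_assoc, ← mul_assoc]
        congr 1
        exact oS_comm h _ _
      · by_cases hb : b = 1
        · subst hb
          rw [oS_one, one_mul] at hv ⊢
          obtain ⟨l', h1, h2⟩ := ih m hm v hv
          exact ⟨l', h1, by simp; omega⟩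
        by_cases hs : S u (wordProd Γ G m) = 1
        · exact absurd (S_non h h' b hb _ hs) hv
        · obtain ⟨m', h1, h2⟩ := ih m hm u hs
          have e : wordProd Γ G (⟨u, b * S u (wordProd Γ G m)⟩ :: m') =
              oS Γ b * wordProd Γ G m := by
            rw [P_cons, h1]
            change oS Γ (b * S u (wordProd Γ G m)) * _ = _
            rw [oS_mul, oS_inv]; group
          rw [← e] at hv ⊢
          obtain ⟨l', h3, h4⟩ := ih (⟨u, b * S u (wordProd Γ G m)⟩ :: m')
            (by simp; omega) v hv
          refine ⟨l', h3, h4.trans_le ?_⟩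
          simp; omega

lemma len_mul {v : V} {a : G v} (ha : a ≠ 1) {g : GraphProduct Γ G} (hg : S v g = 1) :
    redLength Γ G (oS Γ a * g) = redLength Γ G g + 1 := by
  apply le_antisymm
  · have := len_mul_le (oS Γ a) g
    have := len_oS (Γ := Γ) a
    omega
  · obtain ⟨w, h1, h2⟩ := exists_geo (oS Γ a * g)
    have h3 : S v (wordProd Γ G w) = a := by rw [h1, S_mul, hg, mul_one]
    obtain ⟨l', h4, h5⟩ := drop_word _ w le_rfl v (by rwa [h3])
    rw [h3, h1, oS_inv, inv_mul_cancel_left] at h4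
    have := len_le h4
    omega

lemma S_rest {v : V} (g : GraphProduct Γ G) : S v (oS Γ (S v g)⁻¹ * g) = 1 := by
  rw [S_mul]; simp

lemma len_rest {v : V} {g : GraphProduct Γ G} (h : S v g ≠ 1) :
    redLength Γ G g = redLength Γ G (oS Γ (S v g)⁻¹ * g) + 1 := by
  rw [← len_mul h (S_rest g), oS_inv, mul_inv_cancel_left]

lemma mem_half (v : V) (g : GraphProduct Γ G) : g ∈ halfSpace Γ G v ↔ S v g ≠ 1 := by
  constructor
  · rintro ⟨a, ha⟩ h
    by_cases h1 : a = 1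
    · subst h1
      have := oS_one (Γ := Γ) (G := G) v
      unfold oS at this
      rw [this, one_mul] at ha
      omega
    · have := len_mul h1 h
      unfold oS at this
      omega
  · intro h
    refine ⟨(S v g)⁻¹, ?_⟩
    have := len_rest h
    unfold oS at this
    omega

lemma mem_wall (k : GraphProduct Γ G) (v : V) (x : GraphProduct Γ G) :
    x ∈ wallTrans Γ G k (halfSpace Γ G v) ↔ S v (k⁻¹ * x) ≠ 1 := by
  rw [← mem_half]
  constructor
  · rintro ⟨y, hy, rfl⟩; simpa
  · intro h; exact ⟨_, h, by simp⟩

lemma geo_cons {s : (v : V) × G v} {l} (h : redLength Γ G (wordProd Γ G (s :: l)) = (s :: l).length) :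
    redLength Γ G (wordProd Γ G l) = l.length ∧ S s.1 (wordProd Γ G l) = 1 ∧ s.2 ≠ 1 := by
  obtain ⟨u, b⟩ := s
  have hP : wordProd Γ G (⟨u, b⟩ :: l) = oS Γ b * wordProd Γ G l := P_cons _ _
  rw [hP, List.length_cons] at h
  have h0 := len_le (Γ := Γ) (G := G) (w := l) rfl
  have h1 := len_mul_le (oS Γ b) (wordProd Γ G l)
  have h2 := len_oS (Γ := Γ) b
  refine ⟨by omega, ?_, ?_⟩
  · by_contra hs
    simp only at hs
    have h3 := len_rest hs
    have h4 := len_mul_le (oS Γ (b * S u (wordProd Γ G l)))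
      (oS Γ (S u (wordProd Γ G l))⁻¹ * wordProd Γ G l)
    have h5 := len_oS (Γ := Γ) (b * S u (wordProd Γ G l))
    rw [oS_mul, oS_inv, mul_assoc, mul_inv_cancel_left, ← oS_inv, ← oS_mul] at h4
    omega
  · intro hb
    change b = 1 at hb
    simp only [hb, oS_one, one_mul] at h
    omega

/-- every link syllable is blocked inside the word -/
def Bk (Γ : SimpleGraph V) (v : V) : List ((v : V) × G v) → Prop
  | [] => True
  | s :: l => (Γ.Adj v s.1 → ∃ t ∈ l, ¬ Γ.Adj t.1 s.1) ∧ Bk Γ v l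

lemma key (v : V) (a : G v) (ha : a ≠ 1) (r : GraphProduct Γ G) (hr : S v r = 1)
    (l : List ((v : V) × G v))
    (hg : redLength Γ G (wordProd Γ G (l ++ [⟨v, a⟩])) = (l ++ [(⟨v, a⟩ : (v : V) × G v)]).length)
    (hb : Bk Γ v l) :
    (∀ w, (¬ Γ.Adj v w ∨ ∃ t ∈ l, ¬ Γ.Adj t.1 w) →
      S w (wordProd Γ G l * (oS Γ a * r)) = S w (wordProd Γ G l * oS Γ a)) ∧
    redLength Γ G (wordProd Γ G l * (oS Γ a * r)) = l.length + 1 + redLength Γ G r := by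
  induction l with
  | nil =>
    constructor
    · intro w hw
      replace hw : ¬ Γ.Adj v w := by simpa using hw
      rw [P_nil, one_mul, one_mul]
      rcases tri Γ v w with rfl | h | ⟨h, h'⟩
      · have := S_mul v a (1 : GraphProduct Γ G)
        rw [S_one, mul_one] at this
        rw [S_mul, hr, this, mul_one]
      · exact absurd h hw
      · have := S_non h h' a ha 1 (S_one _)
        rw [mul_one] at this
        rw [this, S_non h h' a ha r hr]
    · rw [P_nil, one_mul, len_mul ha hr]
      simp; omega
  | cons s l ih =>
    obtain ⟨u, b⟩ := s
    obtain ⟨g1, g2, g3⟩ := geo_cons (s := ⟨u, b⟩) (l := l ++ [⟨v, a⟩]) hg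
    obtain ⟨i1, i2⟩ := ih g1 hb.2
    have hP : wordProd Γ G (⟨u, b⟩ :: l) = oS Γ b * wordProd Γ G l := P_cons _ _
    simp only [P_append, P_cons, P_nil, mul_one] at g2
    have hu : S u (wordProd Γ G l * (oS Γ a * r)) = 1 := by
      rw [i1 u, g2]
      by_cases h : Γ.Adj v u
      · exact Or.inr (hb.1 h)
      · exact Or.inl h
    rw [hP]
    constructor
    · intro w hw
      rw [mul_assoc, mul_assoc]
      rcases tri Γ u w with rfl | h | ⟨h, h'⟩
      · rw [S_mul, S_mul, hu, g2]
      · rw [S_adj h, S_adj h]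
        apply i1
        rcases hw with hw | ⟨t, ht, ht'⟩
        · exact Or.inl hw
        · rcases List.mem_cons.1 ht with rfl | ht
          · exact absurd h ht'
          · exact Or.inr ⟨t, ht, ht'⟩
      · rw [S_non h h' b g3 _ hu, S_non h h' b g3 _ g2]
    · rw [mul_assoc, len_mul g3 hu, i2]
      simp; omega

lemma key2 (v : V) (a : G v) (l : List ((v : V) × G v))
    (hg : redLength Γ G (wordProd Γ G (l ++ [⟨v, a⟩])) = (l ++ [(⟨v, a⟩ : (v : V) × G v)]).length)
    (hl : redLength Γ G (wordProd Γ G l) = l.length)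
    (w : V) (hw : ∃ t ∈ l, ¬ Γ.Adj t.1 w) :
    S w (wordProd Γ G l * oS Γ a) = S w (wordProd Γ G l) := by
  induction l with
  | nil => simp at hw
  | cons s l ih =>
    obtain ⟨u, b⟩ := s
    obtain ⟨g1, g2, g3⟩ := geo_cons (s := ⟨u, b⟩) (l := l ++ [⟨v, a⟩]) hg
    obtain ⟨l1, l2, l3⟩ := geo_cons hl
    have hP : wordProd Γ G (⟨u, b⟩ :: l) = oS Γ b * wordProd Γ G l := P_cons _ _
    simp only [P_append, P_cons, P_nil, mul_one] at g2
    rw [hP, mul_assoc]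
    rcases tri Γ u w with rfl | h | ⟨h, h'⟩
    · rw [S_mul, S_mul, l2, g2]
    · rw [S_adj h, S_adj h]
      apply ih g1 l1
      obtain ⟨t, ht, ht'⟩ := hw
      rcases List.mem_cons.1 ht with rfl | ht
      · exact absurd h ht'
      · exact ⟨t, ht, ht'⟩
    · rw [S_non h h' b g3 _ l2, S_non h h' b g3 _ g2]

lemma comm_word {u : V} (b : G u) (m) (hm : ∀ t ∈ m, Γ.Adj t.1 u) :
    oS Γ b * wordProd Γ G m = wordProd Γ G m * oS Γ b := by
  induction m with
  | nil => simp
  | cons s l ih =>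
    have h1 : Γ.Adj s.1 u := hm s (by simp)
    rw [P_cons, mul_assoc, ← ih (fun t ht => hm t (by simp [ht])), ← mul_assoc, ← mul_assoc]
    congr 1
    exact (oS_comm h1 s.2 b).symm

lemma S_word {w : V} (g : GraphProduct Γ G) (m) (hm : ∀ t ∈ m, Γ.Adj t.1 w) :
    S w (wordProd Γ G m * g) = S w g := by
  induction m with
  | nil => simp
  | cons s l ih =>
    have h1 : Γ.Adj s.1 w := hm s (by simp)
    rw [P_cons, mul_assoc, ← ih (fun t ht => hm t (by simp [ht]))]
    exact S_adj h1 s.2 _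

/-- minimality with respect to the link of `v` -/
def LMin (v : V) (p : GraphProduct Γ G) : Prop :=
  ∀ u, Γ.Adj v u → ∀ b : G u, redLength Γ G p ≤ redLength Γ G (p * oS Γ b)

lemma bk_of_min (v : V) (m : List ((v : V) × G v)) : ∀ l : List ((v : V) × G v),
    redLength Γ G (wordProd Γ G (l ++ m)) = (l ++ m).length →
    LMin v (wordProd Γ G (l ++ m)) → Bk Γ v m := by
  induction m with
  | nil => intros; trivial
  | cons s m ih =>
    intro l hl hmin
    refine ⟨?_, ?_⟩
    · intro hv
      by_contra! hcon
      obtain ⟨u, b⟩ := s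
      have h1 := hmin u hv b⁻¹
      have h2 : wordProd Γ G (l ++ m) = wordProd Γ G (l ++ ⟨u, b⟩ :: m) * oS Γ b⁻¹ := by
        have := comm_word (Γ := Γ) b m hcon
        unfold oS at this
        rw [P_append, P_append, P_cons, this, oS_inv]
        unfold oS
        group
      have h3 := len_le h2
      simp only [List.length_append, List.length_cons] at hl h3
      omega
    · have e : l ++ [s] ++ m = l ++ s :: m := by simp
      exact ih (l ++ [s]) (by rw [e]; exact hl) (by rw [e]; exact hmin)

lemma base (v : V) (p : GraphProduct Γ G) (a : G v) (ha : a ≠ 1) (hp : LMin v p)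
    (hpa : redLength Γ G (p * oS Γ a) = redLength Γ G p + 1)
    (r : GraphProduct Γ G) (hr : S v r = 1) :
    (∀ w, ¬ Γ.Adj v w → S w (p * (oS Γ a * r)) = S w (p * oS Γ a)) ∧
    redLength Γ G (p * (oS Γ a * r)) = redLength Γ G p + 1 + redLength Γ G r := by
  obtain ⟨l, rfl, h2⟩ := exists_geo p
  have hb := bk_of_min v l [] h2 hp
  have := key v a ha r hr l (by simpa [h2] using hpa) hb
  exact ⟨fun w hw => this.1 w (Or.inl hw), by rw [this.2, h2]⟩

lemma lmin_one_of_link (v : V) (l : List ((v : V) × G v))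
    (hl : redLength Γ G (wordProd Γ G l) = l.length) (hmin : LMin v (wordProd Γ G l))
    (h : ∀ t ∈ l, Γ.Adj t.1 v) : l = [] := by
  rcases l.eq_nil_or_concat with rfl | ⟨m, s, rfl⟩
  · rfl
  · exfalso
    rw [List.concat_eq_append] at *
    obtain ⟨u, b⟩ := s
    have h1 := hmin u (h ⟨u, b⟩ (by simp)).symm b⁻¹
    have h2 : wordProd Γ G m = wordProd Γ G (m ++ [⟨u, b⟩]) * oS Γ b⁻¹ := by
      rw [oS_inv]; simp
    have h3 := len_le h2
    simp only [List.length_append, List.length_cons] at hl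
    omega

lemma len_right {v : V} {k : GraphProduct Γ G} (hk : S v k⁻¹ = 1) {a : G v} (ha : a ≠ 1) :
    redLength Γ G (k * oS Γ a) = redLength Γ G k + 1 := by
  rw [← len_inv, mul_inv_rev, ← oS_inv, len_mul (inv_ne_one.2 ha) hk, len_inv]

lemma caseA (v : V) (k : GraphProduct Γ G) (hk : LMin v k) (hs : S v k⁻¹ = 1)
    (a : G v) (ha : a ≠ 1) (r : GraphProduct Γ G) (hr : S v r = 1) :
    redLength Γ G (k * (oS Γ a * r)) = redLength Γ G k + 1 + redLength Γ G r ∧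
    ∀ w, ¬ Γ.Adj v w → (k ≠ 1 ∨ w ≠ v) → S w (k * (oS Γ a * r)) = S w k := by
  have hka := len_right hs ha
  obtain ⟨b1, b2⟩ := base v k a ha hk hka r hr
  refine ⟨b2, fun w hw hkw => ?_⟩
  rw [b1 w hw]
  obtain ⟨l, rfl, h2⟩ := exists_geo k
  by_cases h : ∃ t ∈ l, ¬ Γ.Adj t.1 w
  · exact key2 v a l (by simpa [h2] using hka) h2 w h
  · push Not at h
    have hwv : v ≠ w := by
      rintro rfl
      have := lmin_one_of_link v l h2 hk h
      subst this
      simp at hkw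
    rw [S_word _ l h]
    have h3 := S_word (Γ := Γ) (1 : GraphProduct Γ G) l h
    rw [mul_one, S_one] at h3
    have h4 := S_non hw hwv a ha 1 (S_one _)
    rw [mul_one] at h4
    rw [h3, h4]

lemma caseB (v : V) (k : GraphProduct Γ G) (hk : LMin v k) (hs : S v k⁻¹ ≠ 1)
    (r : GraphProduct Γ G) (hr : S v r = 1) :
    redLength Γ G (k * r) = redLength Γ G k + redLength Γ G r ∧
    ∀ w, ¬ Γ.Adj v w → S w (k * r) = S w k := by
  set c : G v := S v k⁻¹ with hc
  have hlen := len_rest hs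
  rw [← hc] at hlen
  have e : (oS Γ c⁻¹ * k⁻¹) = (k * oS Γ c)⁻¹ := by rw [oS_inv, mul_inv_rev]
  rw [e, len_inv, len_inv] at hlen
  have hp : LMin v (k * oS Γ c) := by
    intro u hu b
    have h1 := hk u hu b
    have h2 := len_mul_le (k * oS Γ c * oS Γ b) (oS Γ c⁻¹)
    have h3 := len_oS (Γ := Γ) c⁻¹
    have h4 : k * oS Γ c * oS Γ b * oS Γ c⁻¹ = k * oS Γ b := by
      rw [mul_assoc k, oS_comm hu, oS_inv]; group
    rw [h4] at h2
    omega
  have h5 : k * oS Γ c * oS Γ c⁻¹ = k := by rw [oS_inv]; group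
  obtain ⟨b1, b2⟩ := base v (k * oS Γ c) c⁻¹ (inv_ne_one.2 hs) hp (by rw [h5]; omega) r hr
  rw [← mul_assoc, h5] at b2
  refine ⟨by omega, fun w hw => ?_⟩
  have := b1 w hw
  rwa [← mul_assoc, h5] at this

lemma wall_link {v u : V} (h : Γ.Adj v u) (b : G u) (k : GraphProduct Γ G) :
    wallTrans Γ G (k * oS Γ b) (halfSpace Γ G v) = wallTrans Γ G k (halfSpace Γ G v) := by
  ext x
  rw [mem_wall, mem_wall, mul_inv_rev, ← oS_inv, mul_assoc, S_adj h.symm]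

lemma lmin_of_min {v : V} {k : GraphProduct Γ G}
    (h : ∀ h, wallTrans Γ G h (halfSpace Γ G v) = wallTrans Γ G k (halfSpace Γ G v) →
      redLength Γ G k ≤ redLength Γ G h) : LMin v k :=
  fun _ hu b => h _ (wall_link hu b k)

lemma uniq {v : V} {g h : GraphProduct Γ G} (hh : LMin v h)
    (hl : redLength Γ G g = redLength Γ G h) (hv : Nontrivial (G v))
    (e : wallTrans Γ G g (halfSpace Γ G v) = wallTrans Γ G h (halfSpace Γ G v)) : g = h := by
  have e' : ∀ x, S v (g⁻¹ * x) = 1 ↔ S v (h⁻¹ * x) = 1 := by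
    intro x
    have := Set.ext_iff.1 e x
    rw [mem_wall, mem_wall] at this
    exact not_iff_not.1 this
  have h1 := e' 1
  rw [mul_one, mul_one] at h1
  by_cases hs : S v h⁻¹ = 1
  · obtain ⟨a, ha⟩ := exists_ne (1 : G v)
    have h2 : S v (h⁻¹ * (g * oS Γ a)) ≠ 1 := by
      rw [Ne, ← e', inv_mul_cancel_left]
      have := S_mul v a (1 : GraphProduct Γ G)
      rw [mul_one, S_one, mul_one] at this
      rwa [this]
    set a' := S v (h⁻¹ * (g * oS Γ a)) with ha'
    set r := oS Γ a'⁻¹ * (h⁻¹ * (g * oS Γ a)) with hr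
    have h3 := (caseA v h hh hs a' h2 r (S_rest _)).1
    have h4 : h * (oS Γ a' * r) = g * oS Γ a := by rw [hr, oS_inv]; group
    have h5 := len_right (h1.2 hs) ha
    rw [h4, h5] at h3
    have h6 : r = 1 := len_zero (by omega)
    rw [h6, mul_one] at h4
    have h7 : g = h * oS Γ (a' * a⁻¹) := by
      rw [oS_mul, oS_inv, ← mul_assoc, h4]; group
    by_cases h8 : a' * a⁻¹ = 1
    · rw [h7, h8, oS_one, mul_one]
    · have := len_right hs h8
      rw [← h7] at this
      omega
  · have h2 : S v (h⁻¹ * g) = 1 := by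
      rw [← e', inv_mul_cancel, S_one]
    have h3 := (caseB v h hh hs _ h2).1
    rw [mul_inv_cancel_left] at h3
    have h4 : h⁻¹ * g = 1 := len_zero (by omega)
    exact (inv_mul_eq_one.1 h4).symm

lemma partB (k : GraphProduct Γ G) (v w : V) (hw : w = v ∨ ¬ Γ.Adj v w) (hk : LMin v k) :
    ¬ Cross (wallTrans Γ G k (halfSpace Γ G v)) (halfSpace Γ G w) := by
  have hw' : ¬ Γ.Adj v w := by
    rcases hw with rfl | hw
    · exact Γ.irrefl
    · exact hw
  rintro ⟨⟨x, x1, x2⟩, ⟨y, y1, y2⟩, ⟨z, z1, z2⟩, ⟨t, t1, t2⟩⟩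
  simp only [Set.mem_compl_iff, mem_wall, mem_half, not_not] at *
  by_cases hs : S v k⁻¹ = 1
  · by_cases hkw : k ≠ 1 ∨ w ≠ v
    · have key : ∀ x, S v (k⁻¹ * x) ≠ 1 → S w x = S w k := by
        intro x hx
        have := (caseA v k hk hs _ hx _ (S_rest (k⁻¹ * x))).2 w hw' hkw
        rwa [oS_inv, mul_inv_cancel_left, mul_inv_cancel_left] at this
      rw [key x x1] at x2
      rw [key y y1] at y2
      exact x2 y2
    · push Not at hkw
      obtain ⟨rfl, rfl⟩ := hkw
      simp at y1
      exact y1 y2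
  · have key : ∀ x, S v (k⁻¹ * x) = 1 → S w x = S w k := by
      intro x hx
      have := (caseB v k hk hs _ hx).2 w hw'
      rwa [mul_inv_cancel_left] at this
    rw [key z z1] at z2
    rw [key t t1] at t2
    exact z2 t2

lemma partA (k : GraphProduct Γ G) (v : V) :
    ∃! h : GraphProduct Γ G,
      wallTrans Γ G h (halfSpace Γ G v) = wallTrans Γ G k (halfSpace Γ G v) ∧
      ∀ h' : GraphProduct Γ G,
        wallTrans Γ G h' (halfSpace Γ G v) = wallTrans Γ G k (halfSpace Γ G v) →
        redLength Γ G h ≤ redLength Γ G h' := by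
  obtain ⟨m, hm, hm'⟩ := WellFounded.has_min (measure (redLength Γ G)).wf
    {h | wallTrans Γ G h (halfSpace Γ G v) = wallTrans Γ G k (halfSpace Γ G v)} ⟨k, rfl⟩
  have hmin : ∀ h', wallTrans Γ G h' (halfSpace Γ G v) = wallTrans Γ G k (halfSpace Γ G v) →
      redLength Γ G m ≤ redLength Γ G h' := fun h' hh => not_lt.1 (hm' h' hh)
  refine ⟨m, ⟨hm, hmin⟩, ?_⟩
  rintro y ⟨hy, hymin⟩
  have hm2 : wallTrans Γ G m (halfSpace Γ G v) = wallTrans Γ G k (halfSpace Γ G v) := hm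
  have hlen : redLength Γ G y = redLength Γ G m := le_antisymm (hymin m hm2) (hmin y hy)
  rcases subsingleton_or_nontrivial (G v) with hv | hv
  · have h0 : redLength Γ G m ≤ 0 := by
      rw [← len_one (Γ := Γ) (G := G)]
      apply hmin
      ext x
      rw [mem_wall, mem_wall]
      simp [Subsingleton.elim _ (1 : G v)]
    rw [len_zero (g := m) (by omega), len_zero (g := y) (by omega)]
  · exact uniq (lmin_of_min (by rw [hm2]; exact hmin))
      hlen hv (hy.trans hm2.symm)

end
end GP

section Statements

variable {V : Type} [Fintype V] (Γ : SimpleGraph V) (G : V → Type) [∀ v, Group (G v)]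

theorem stmt8 (k : GraphProduct Γ G) (v : V) :
    (∃! h : GraphProduct Γ G,
      wallTrans Γ G h (halfSpace Γ G v) = wallTrans Γ G k (halfSpace Γ G v) ∧
      ∀ h' : GraphProduct Γ G,
        wallTrans Γ G h' (halfSpace Γ G v) = wallTrans Γ G k (halfSpace Γ G v) →
        redLength Γ G h ≤ redLength Γ G h') ∧
    (∀ w : V, (w = v ∨ ¬ Γ.Adj v w) →
      (∀ h : GraphProduct Γ G,
        wallTrans Γ G h (halfSpace Γ G v) = wallTrans Γ G k (halfSpace Γ G v) →
        redLength Γ G k ≤ redLength Γ G h) →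
      ¬ Cross (wallTrans Γ G k (halfSpace Γ G v)) (halfSpace Γ G w)) := by
  exact ⟨GP.partA k v, fun w hw hk => GP.partB k v w hw (GP.lmin_of_min hk)⟩

end Statements
end
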